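/- arXiv:2604.19026 — 5 statements merged into one kernel-verified Lean document; each statement's English description precedes it below -/
import Mathlib

section
/- Let n be a positive integer and let L be a list of n real numbers. Suppose there exist a real number c, a real number ε ≥ 0, and a subset H of the entries of L (counted with multiplicity) with |H| > n/2 such that every entry h in H satisfies |h − c| ≤ ε. Then the median of L — i.e., the ⌈n/2⌉-th smallest entry of L (and likewise the (⌊n/2⌋+1)-th smallest entry) — lies in the interval [c − ε, c + ε]. In particular, for any adversarial choice of the remaining fewer than n/2 entries, the median deviates from c by at most the maximum deviation of the entries in H from c. -/
/-- **Median breakdown.** If a majority (counted with multiplicity) of the `n` entries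
of a list `L` of reals lie within `ε` of a reference value `c`, then any order
statistic of rank `k` with `⌈n/2⌉ ≤ k ≤ ⌊n/2⌋ + 1` (i.e., any median of `L`)
lies in `[c - ε, c + ε]`. -/
theorem median_breakdown
    (n : ℕ) (hn : 0 < n) (L : List ℝ) (hL : L.length = n)
    (c ε : ℝ) (hε : 0 ≤ ε)
    (H : List ℝ) (hH : H.Subperm L)
    (hmaj : n < 2 * H.length)
    (hhon : ∀ h ∈ H, |h - c| ≤ ε)
    (k : ℕ) (hk1 : (n + 1) / 2 ≤ k) (hk2 : k ≤ n / 2 + 1) :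
    |(List.insertionSort (· ≤ ·) L).getD (k - 1) 0 - c| ≤ ε := by
  classical
  set S := List.insertionSort (· ≤ ·) L with hS
  have hperm : S.Perm L := List.perm_insertionSort _ L
  have hlen : S.length = n := by rw [hperm.length_eq, hL]
  have hHS : H.Subperm S := hH.trans hperm.symm.subperm
  have hsort : S.Pairwise (· ≤ ·) := List.pairwise_insertionSort _ L
  have hk : k - 1 < S.length := by omega
  rw [List.getD_eq_getElem _ _ hk]
  have mono : ∀ (i j : ℕ) (hi : i < S.length) (hj : j < S.length), i ≤ j → S[i] ≤ S[j] := by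
    intro i j hi hj hij
    rcases Nat.lt_or_eq_of_le hij with h | h
    · exact List.pairwise_iff_getElem.mp hsort i j hi hj h
    · subst h; exact le_rfl
  have key : H.length ≤ S.countP (fun x => decide (|x - c| ≤ ε)) := by
    have h1 : H.countP (fun x => decide (|x - c| ≤ ε)) = H.length := by
      rw [List.countP_eq_length]
      intro a ha
      simpa using hhon a ha
    rw [← h1]
    exact hHS.countP_le _
  rw [abs_le]
  constructor
  · by_contra hcon
    push Not at hcon
    have h0 : (S.take k).countP (fun x => decide (|x - c| ≤ ε)) = 0 := by
      rw [List.countP_eq_zero]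
      intro a ha
      obtain ⟨i, hi, rfl⟩ := List.mem_iff_getElem.mp ha
      rw [List.length_take] at hi
      have := mono i (k-1) (by omega) hk (by omega)
      rw [List.getElem_take]
      simp only [decide_eq_true_eq, abs_le, not_and_or]
      left; linarith
    rw [← List.take_append_drop k S, List.countP_append, h0] at key
    have h2 := List.countP_le_length (p := fun x => decide (|x - c| ≤ ε)) (l := S.drop k)
    rw [List.length_drop] at h2
    omega
  · by_contra hcon
    push Not at hcon
    have h0 : (S.drop (k-1)).countP (fun x => decide (|x - c| ≤ ε)) = 0 := by
      rw [List.countP_eq_zero]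
      intro a ha
      obtain ⟨i, hi, rfl⟩ := List.mem_iff_getElem.mp ha
      rw [List.length_drop] at hi
      have := mono (k-1) (k-1+i) hk (by omega) (by omega)
      rw [List.getElem_drop]
      simp only [decide_eq_true_eq, abs_le, not_and_or]
      right; linarith
    rw [← List.take_append_drop (k-1) S, List.countP_append, h0] at key
    have h2 := List.countP_le_length (p := fun x => decide (|x - c| ≤ ε)) (l := S.take (k-1))
    rw [List.length_take] at h2
    omega
end

section
/- Let n and k be natural numbers with n > 2k, and let L be a list of n real numbers. Suppose there exist c ∈ ℝ, ε ≥ 0, and a subset B of the entries of L with |B| ≤ k (the adversarial entries) such that every entry of L not in B lies in [c − ε, c + ε]. Sort L and remove the k largest and k smallest entries. Then every one of the remaining n − 2k entries lies in [c − ε, c + ε], and consequently the trimmed mean — the arithmetic mean of the remaining n − 2k entries — satisfies |trimmedMean − c| ≤ ε. -/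
theorem aux_count (B G S : List ℝ) (k : ℕ) (hperm : S.Perm (B ++ G)) (hB : B.length ≤ k)
    (p : ℝ → Bool) (hG : ∀ g ∈ G, p g = false) : S.countP p ≤ k := by
  rw [hperm.countP_eq p, List.countP_append]
  have h1 : G.countP p = 0 := by
    rw [List.countP_eq_zero]
    intro a ha
    simp [hG a ha]
  have h2 := List.countP_le_length (p := p) (l := B)
  omega

theorem aux_sum (c ε : ℝ) (M : List ℝ) (h : ∀ x ∈ M, |x - c| ≤ ε) :
    |M.sum - M.length * c| ≤ M.length * ε := by
  induction M with
  | nil => simp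
  | cons a t ih =>
    have h1 := ih (fun x hx => h x (List.mem_cons_of_mem _ hx))
    have h2 := h a List.mem_cons_self
    rw [abs_le] at *
    simp only [List.sum_cons, List.length_cons]
    push_cast
    constructor <;> linarith [h1.1, h1.2, h2.1, h2.2]

/-- **Trimmed-mean breakdown.** Let `L` be a list of `n > 2k` reals that is a
permutation of `B ++ G`, where `B` (the adversarial entries, counted with
multiplicity) has at most `k` elements and every honest entry `g ∈ G` lies in
`[c - ε, c + ε]`. Sort `L` and delete the `k` smallest and `k` largest entries.
Then every remaining entry lies in `[c - ε, c + ε]`, and the trimmed mean —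
the arithmetic mean of the remaining `n - 2k` entries — deviates from `c` by
at most `ε`. -/
theorem trimmedMean_breakdown
    (n k : ℕ) (hnk : 2 * k < n) (L : List ℝ) (hL : L.length = n)
    (c ε : ℝ) (hε : 0 ≤ ε)
    (B G : List ℝ) (hperm : L.Perm (B ++ G)) (hB : B.length ≤ k)
    (hG : ∀ g ∈ G, |g - c| ≤ ε) :
    (∀ x ∈ ((List.insertionSort (· ≤ ·) L).drop k).take (n - 2 * k),
        |x - c| ≤ ε) ∧
    |(((List.insertionSort (· ≤ ·) L).drop k).take (n - 2 * k)).sum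
        / (n - 2 * k : ℝ) - c| ≤ ε := by
  have hsort : (List.insertionSort (· ≤ ·) L).Pairwise (· ≤ ·) :=
    List.pairwise_insertionSort _ _
  have hSp : (List.insertionSort (· ≤ ·) L).Perm (B ++ G) :=
    (List.perm_insertionSort _ _).trans hperm
  have hlen : (List.insertionSort (· ≤ ·) L).length = n := by
    rw [List.length_insertionSort, hL]
  generalize List.insertionSort (· ≤ ·) L = S at *
  have hS : S = S.take k ++ ((S.drop k).take (n - 2 * k) ++ (S.drop k).drop (n - 2 * k)) := by
    rw [List.take_append_drop, List.take_append_drop]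
  have hA : (S.take k).length = k := by rw [List.length_take]; omega
  have hM : ((S.drop k).take (n - 2 * k)).length = n - 2 * k := by
    rw [List.length_take, List.length_drop]; omega
  have hD : ((S.drop k).drop (n - 2 * k)).length = k := by
    rw [List.length_drop, List.length_drop]; omega
  generalize S.take k = A at *
  generalize (S.drop k).take (n - 2 * k) = M at *
  generalize (S.drop k).drop (n - 2 * k) = D at *
  subst hS
  rw [List.pairwise_append, List.pairwise_append] at hsort
  obtain ⟨-, ⟨-, -, hMD⟩, hAM⟩ := hsort
  have key : ∀ x ∈ M, |x - c| ≤ ε := by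
    intro x hx
    rw [abs_le]
    constructor
    · by_contra hlt
      have h1 := aux_count B G _ k hSp hB (fun y => decide (y - c < -ε)) (by
        intro g hg
        have := (abs_le.1 (hG g hg)).1
        simpa using this)
      rw [List.countP_append, List.countP_append] at h1
      have h2 : A.countP (fun y => decide (y - c < -ε)) = A.length := by
        rw [List.countP_eq_length]
        intro a ha
        have := hAM a ha x (List.mem_append_left _ hx)
        rw [decide_eq_true_eq]
        linarith
      have h3 : 0 < M.countP (fun y => decide (y - c < -ε)) := by
        rw [List.countP_pos_iff]
        exact ⟨x, hx, by rw [decide_eq_true_eq]; linarith⟩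
      omega
    · by_contra hlt
      have h1 := aux_count B G _ k hSp hB (fun y => decide (ε < y - c)) (by
        intro g hg
        have := (abs_le.1 (hG g hg)).2
        rw [decide_eq_false_iff_not]
        linarith)
      rw [List.countP_append, List.countP_append] at h1
      have h2 : D.countP (fun y => decide (ε < y - c)) = D.length := by
        rw [List.countP_eq_length]
        intro a ha
        have := hMD x hx a ha
        rw [decide_eq_true_eq]
        linarith
      have h3 : 0 < M.countP (fun y => decide (ε < y - c)) := by
        rw [List.countP_pos_iff]
        exact ⟨x, hx, by rw [decide_eq_true_eq]; linarith⟩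
      omega
  refine ⟨key, ?_⟩
  have hs := aux_sum c ε M key
  have hc : (M.length : ℝ) = n - 2 * k := by
    rw [hM, Nat.cast_sub hnk.le]; push_cast; ring
  rw [hc] at hs
  have hpos : (0 : ℝ) < n - 2 * k := by
    have : ((2 * k : ℕ) : ℝ) < n := by exact_mod_cast hnk
    push_cast at this
    linarith
  generalize (n : ℝ) - 2 * k = m at *
  have he : M.sum / m - c = (M.sum - m * c) / m := by field_simp
  rw [he, abs_div, abs_of_pos hpos, div_le_iff₀ hpos]
  linarith
end

section
/- Fix λ ∈ [0,1), δ ≥ 0, and I_0 > 0. Let I* : ℕ → ℝ be the honest index, η_t ∈ ℝ a publication error at epoch t, and Ī_{t−1} > 0 the previously published index. Define the published value Ī_t = clip(λ·Ī_{t−1} + (1−λ)·(I*_t + η_t), (1−δ)·Ī_{t−1}, (1+δ)·Ī_{t−1}), where clip(x, lo, hi) = max(lo, min(hi, x)). Suppose |Ī_{t−1} − I*_{t−1}| ≤ E, |I*_t − I*_{t−1}| ≤ d, and |η_t| ≤ B. Then |Ī_t − I*_t| ≤ max( λ(E + d) + (1−λ)B, δ·Ī_{t−1} + E + d ). Moreover,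 if the value Ī_t is read at a stale epoch θ with t ≤ θ ≤ t + τ and |I*_s − I*_{s−1}| ≤ d for all t < s ≤ θ, then the NAV deviation satisfies |Ī_t/I_0 − I*_θ/I_0| ≤ (1/I_0)·( max( λ(E + d) + (1−λ)B, δ·Ī_{t−1} + E + d ) + τ·d ). -/
/-- Clip `x` to the interval `[lo, hi]`. -/
noncomputable def clip (x lo hi : ℝ) : ℝ := max lo (min hi x)

/-- **NAV deviation bound.** The published index is the EMA (smoothing `λ ∈ [0,1)`)
of the raw observation `I*_t + η_t`, clipped to within relative drift cap `δ` of
the previous published value `Ī_{t-1} > 0`. If the previous publication error is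
at most `E`, the honest per-epoch movement is at most `d`, and the observation
noise is at most `B`, then the new publication error is at most
`max (λ(E+d) + (1-λ)B) (δ·Ī_{t-1} + E + d)`; moreover a consumer reading this
value at a stale epoch `θ ∈ [t, t+τ]` incurs a NAV deviation bounded by
`(1/I_0)(max (λ(E+d) + (1-λ)B) (δ·Ī_{t-1} + E + d) + τ·d)`. -/
theorem nav_deviation_bound
    (lam δ I0 : ℝ) (hlam0 : 0 ≤ lam) (hlam1 : lam < 1) (hδ : 0 ≤ δ)
    (hI0 : 0 < I0)
    (Istar : ℕ → ℝ) (η : ℝ) (Iprev : ℝ) (hIprev : 0 < Iprev)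
    (t : ℕ) (ht : 1 ≤ t)
    (E d B : ℝ)
    (hE : |Iprev - Istar (t - 1)| ≤ E)
    (hd : |Istar t - Istar (t - 1)| ≤ d)
    (hB : |η| ≤ B)
    (Ibar : ℝ)
    (hIbar : Ibar = clip (lam * Iprev + (1 - lam) * (Istar t + η))
        ((1 - δ) * Iprev) ((1 + δ) * Iprev)) :
    |Ibar - Istar t| ≤ max (lam * (E + d) + (1 - lam) * B) (δ * Iprev + E + d) ∧
    ∀ (θ τ : ℕ), t ≤ θ → θ ≤ t + τ →
      (∀ s : ℕ, t < s → s ≤ θ → |Istar s - Istar (s - 1)| ≤ d) →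
      |Ibar / I0 - Istar θ / I0| ≤
        (1 / I0) * (max (lam * (E + d) + (1 - lam) * B) (δ * Iprev + E + d)
          + (τ : ℝ) * d) := by
  have hδI : 0 ≤ δ * Iprev := mul_nonneg hδ hIprev.le
  have h1 : (1 - δ) * Iprev ≤ Ibar := by
    rw [hIbar]; exact le_max_left _ _
  have h2 : Ibar ≤ (1 + δ) * Iprev := by
    rw [hIbar]; exact max_le (by nlinarith) (min_le_left _ _)
  have hd0 : 0 ≤ d := (abs_nonneg _).trans hd
  have key : |Ibar - Istar t| ≤
      max (lam * (E + d) + (1 - lam) * B) (δ * Iprev + E + d) := by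
    refine le_trans ?_ (le_max_right _ _)
    rw [abs_le] at hE hd ⊢
    constructor <;> linarith [hE.1, hE.2, hd.1, hd.2]
  refine ⟨key, ?_⟩
  intro θ τ h3 h4 hs
  have drift : ∀ k : ℕ, t + k ≤ θ → |Istar t - Istar (t + k)| ≤ (k : ℝ) * d := by
    intro k
    induction k with
    | zero => intro _; simp
    | succ k ih =>
      intro hk
      have a := ih (by omega)
      have b := hs (t + (k + 1)) (by omega) hk
      have e : t + (k + 1) - 1 = t + k := by omega
      rw [e] at b
      rw [abs_le] at a b ⊢
      push_cast
      constructor <;> linarith [a.1, a.2, b.1, b.2]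
  obtain ⟨k, rfl⟩ := Nat.exists_eq_add_of_le h3
  have hk := drift k le_rfl
  have hkτ : (k : ℝ) * d ≤ (τ : ℝ) * d := by
    apply mul_le_mul_of_nonneg_right _ hd0
    exact_mod_cast (by omega : k ≤ τ)
  rw [← sub_div, abs_div, abs_of_pos hI0, div_eq_inv_mul, one_div]
  apply mul_le_mul_of_nonneg_left _ (inv_nonneg.mpr hI0.le)
  have tri := abs_sub_le Ibar (Istar t) (Istar (t + k))
  linarith
end

section
/- Let A > 0 be vault reserves, S > 0 token supply, N > 0 the NAV, and suppose the coverage ratio Γ = A/(S·N) satisfies Γ ≥ 1. Let 0 < y < S tokens be redeemed at NAV, so the redeemer burns y tokens and receives y·N collateral, leaving reserves A − y·N and supply S − y. Then the post-redemption coverage ratio satisfies (A − y·N)/((S − y)·N) ≥ A/(S·N) ≥ 1; i.e., redeeming at NAV never decreases the coverage ratio when coverage is at least 1. -/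
/-- **Redemption at NAV never decreases coverage at or above one.** With reserves
`A > 0`, supply `S > 0`, NAV `N > 0`, and coverage `Γ = A/(S·N) ≥ 1`, redeeming
`0 < y < S` tokens at NAV (burning `y` tokens, returning `y·N` collateral)
yields post-redemption coverage `(A − y·N)/((S − y)·N) ≥ A/(S·N) ≥ 1`. -/
theorem redeem_preserves_coverage
    (A S N y : ℝ)
    (hA : 0 < A) (hS : 0 < S) (hN : 0 < N)
    (hΓ : 1 ≤ A / (S * N))
    (hy : 0 < y) (hyS : y < S) :
    A / (S * N) ≤ (A - y * N) / ((S - y) * N) ∧ 1 ≤ A / (S * N) := by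
  refine ⟨?_, hΓ⟩
  have hSN : 0 < S * N := mul_pos hS hN
  have h1 : S * N ≤ A := (one_le_div hSN).mp hΓ
  have h2 : 0 < (S - y) * N := mul_pos (sub_pos.mpr hyS) hN
  rw [div_le_div_iff₀ hSN h2]
  have h3 : 0 ≤ (y * N) * (A - S * N) :=
    mul_nonneg (mul_pos hy hN).le (sub_nonneg.mpr h1)
  linarith
end

section
/- Consider vault states (A, S, N) with reserves A > 0, supply S > 0, and NAV N > 0, with coverage Γ = A/(S·N). Fix γ_min ≥ 1 and ρ ≥ δ ≥ 0. Consider any finite sequence of states starting from a state with Γ ≥ γ_min, where each transition is one of: (a) an epoch transition, with A' ≥ (1+ρ)·A, S' = S, and 0 < N' ≤ (1+δ)·N; (b) a mint at NAV of some x > 0, with A' = A + x, S' = S + x/N, N' = N, subject to the post-mint coverage check A'/(S'·N) ≥ γ_min; or (c) a redemption at NAV of some 0 < y < S, with A' = A − y·N, S' = S − y, N' = N. Then every state in the sequence satisfies Γ ≥ γ_min; i.e., the combination of the post-mint coverage check, redemption at NAV, and replenishment at rate ρ ≥ δ preserves the coverage invariant Γ ≥ γ_min under arbitrary interleavings of epoch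 steps, mints, and redemptions. -/
/-- A vault state: reserves `A`, token supply `S`, and NAV `N`. -/
structure VaultState where
  A : ℝ
  S : ℝ
  N : ℝ

/-- The state is valid: positive reserves, supply, and NAV. -/
def VaultState.Valid (st : VaultState) : Prop := 0 < st.A ∧ 0 < st.S ∧ 0 < st.N

/-- Coverage ratio `Γ = A/(S·N)` of a vault state. -/
noncomputable def VaultState.coverage (st : VaultState) : ℝ := st.A / (st.S * st.N)

/-- One vault transition: (a) an epoch step with reserve replenishment at rate at
least `ρ` and NAV growth at most the drift cap `δ`; (b) a mint at NAV subject to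
the post-mint coverage check `Γ' ≥ γ_min`; or (c) a redemption at NAV. -/
inductive VaultStep (ρ δ γmin : ℝ) : VaultState → VaultState → Prop
  | epoch (st : VaultState) (A' N' : ℝ)
      (hA : (1 + ρ) * st.A ≤ A') (hN0 : 0 < N') (hN : N' ≤ (1 + δ) * st.N) :
      VaultStep ρ δ γmin st ⟨A', st.S, N'⟩
  | mint (st : VaultState) (x : ℝ) (hx : 0 < x)
      (hcheck : γmin ≤ (st.A + x) / ((st.S + x / st.N) * st.N)) :
      VaultStep ρ δ γmin st ⟨st.A + x, st.S + x / st.N, st.N⟩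
  | redeem (st : VaultState) (y : ℝ) (hy : 0 < y) (hyS : y < st.S) :
      VaultStep ρ δ γmin st ⟨st.A - y * st.N, st.S - y, st.N⟩

theorem VaultStep.inv {ρ δ γmin : ℝ} (hγ : 1 ≤ γmin) (hδ : 0 ≤ δ) (hρ : δ ≤ ρ)
    {s t : VaultState} (h : VaultStep ρ δ γmin s t)
    (hs : 0 < s.S ∧ 0 < s.N ∧ γmin * (s.S * s.N) ≤ s.A) :
    0 < t.S ∧ 0 < t.N ∧ γmin * (t.S * t.N) ≤ t.A := by
  obtain ⟨hS, hN, hA⟩ := hs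
  cases h with
  | epoch A' N' hA' hN0 hN' =>
    refine ⟨hS, hN0, ?_⟩
    have hg : 0 ≤ γmin * s.S := by positivity
    have h0 : 0 ≤ γmin * (s.S * s.N) := by positivity
    show γmin * (s.S * N') ≤ A'
    calc γmin * (s.S * N') = (γmin * s.S) * N' := by ring
      _ ≤ (γmin * s.S) * ((1 + δ) * s.N) := mul_le_mul_of_nonneg_left hN' hg
      _ = (1 + δ) * (γmin * (s.S * s.N)) := by ring
      _ ≤ (1 + ρ) * s.A := mul_le_mul (by linarith) hA h0 (by linarith)
      _ ≤ A' := hA'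
  | mint x hx hc =>
    have hS' : 0 < s.S + x / s.N := by positivity
    exact ⟨hS', hN, (le_div_iff₀ (mul_pos hS' hN)).1 hc⟩
  | redeem y hy hyS =>
    refine ⟨sub_pos.2 hyS, hN, ?_⟩
    show γmin * ((s.S - y) * s.N) ≤ s.A - y * s.N
    nlinarith [mul_nonneg (sub_nonneg.2 hγ) (mul_pos hy hN).le]

/-- **Coverage invariant under arbitrary interleavings.** Fix `γ_min ≥ 1` and
`ρ ≥ δ ≥ 0`. Any finite sequence of vault states starting from a valid state
with coverage at least `γ_min`, in which each transition is an epoch step, a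
coverage-checked mint at NAV, or a redemption at NAV, keeps coverage at least
`γ_min` at every state of the sequence. -/
theorem coverage_invariant
    (ρ δ γmin : ℝ) (hγ : 1 ≤ γmin) (hδ : 0 ≤ δ) (hρ : δ ≤ ρ)
    (n : ℕ) (seq : ℕ → VaultState)
    (hinit : (seq 0).Valid) (hΓ0 : γmin ≤ (seq 0).coverage)
    (hsteps : ∀ i < n, VaultStep ρ δ γmin (seq i) (seq (i + 1))) :
    ∀ i ≤ n, γmin ≤ (seq i).coverage := by
  have key : ∀ i ≤ n, 0 < (seq i).S ∧ 0 < (seq i).N ∧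
      γmin * ((seq i).S * (seq i).N) ≤ (seq i).A := by
    intro i
    induction i with
    | zero =>
      intro _
      obtain ⟨_, hS, hN⟩ := hinit
      exact ⟨hS, hN, (le_div_iff₀ (mul_pos hS hN)).1 hΓ0⟩
    | succ k ih =>
      intro hk
      exact (hsteps k (by omega)).inv hγ hδ hρ (ih (by omega))
  intro i hi
  obtain ⟨hS, hN, hA⟩ := key i hi
  exact (le_div_iff₀ (mul_pos hS hN)).2 hA
end
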